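/- arXiv:2108.10237 — 3 statements merged into one kernel-verified Lean document; each statement's English description precedes it below -/
import Mathlib

section
/- Let V be an n-dimensional complex inner product space with inner product h, let k be an integer with 1 < k ≤ n, let σ be a real number, and let R be a Kähler-type curvature tensor on V. Suppose that for every k-dimensional complex subspace Σ of V and every X ∈ Σ one has Ric_k(Σ)(X,X̄) ≤ −(k+1)σ|X|². Then for every X ∈ V, (nk + n − k − 2)·S·|X|² + n·Ric(X,X̄) ≤ −n(n+1)(n−1)(k+1)σ·|X|², where S = Σᵢ Ric(eᵢ,ēᵢ) is the scalar curvature (sum over an orthonormal basis (eᵢ) of V). -/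
/-- A Kähler-type curvature tensor on a complex vector space `V`:
`R X Y Z W` stands for `R(X, Ȳ, Z, W̄)`; it is ℂ-linear in the first and third
arguments, conjugate-linear in the second and fourth, and satisfies the
Kähler symmetries. -/
structure KahlerCurvature (V : Type*) [AddCommGroup V] [Module ℂ V] where
  R : V → V → V → V → ℂ
  add1 : ∀ X X' Y Z W, R (X + X') Y Z W = R X Y Z W + R X' Y Z W
  smul1 : ∀ (a : ℂ) (X Y Z W : V), R (a • X) Y Z W = a * R X Y Z W
  add2 : ∀ X Y Y' Z W, R X (Y + Y') Z W = R X Y Z W + R X Y' Z W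
  smul2 : ∀ (a : ℂ) (X Y Z W : V), R X (a • Y) Z W = (starRingEnd ℂ) a * R X Y Z W
  add3 : ∀ X Y Z Z' W, R X Y (Z + Z') W = R X Y Z W + R X Y Z' W
  smul3 : ∀ (a : ℂ) (X Y Z W : V), R X Y (a • Z) W = a * R X Y Z W
  add4 : ∀ X Y Z W W', R X Y Z (W + W') = R X Y Z W + R X Y Z W'
  smul4 : ∀ (a : ℂ) (X Y Z W : V), R X Y Z (a • W) = (starRingEnd ℂ) a * R X Y Z W
  sym13 : ∀ X Y Z W, R X Y Z W = R Z Y X W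
  sym24 : ∀ X Y Z W, R X Y Z W = R X W Z Y
  conj_symm : ∀ X Y Z W, R Y X W Z = (starRingEnd ℂ) (R X Y Z W)


namespace KahlerCurvature

lemma comb_aux {ι : Type*} [DecidableEq ι] (a : ι → ℝ) (c : ℝ) (m : ℕ) (hm : 0 < m) (U : Finset ι)
    (h : ∀ t ⊆ U, t.card = m → ∑ i ∈ t, a i ≤ c) (j : ℕ) (hj : m ≤ j) :
    ∀ W ⊆ U, W.card = j → (m : ℝ) * ∑ i ∈ W, a i ≤ j * c := by
  induction j, hj using Nat.le_induction with
  | base =>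
    intro W hW hc
    exact mul_le_mul_of_nonneg_left (h W hW hc) (by positivity)
  | succ j hj ih =>
    intro W hW hc
    have h1 : ∀ i ∈ W, (m : ℝ) * ((∑ l ∈ W, a l) - a i) ≤ j * c := by
      intro i hi
      have h2 := ih (W.erase i) ((Finset.erase_subset _ _).trans hW)
        (by rw [Finset.card_erase_of_mem hi, hc]; rfl)
      rwa [Finset.sum_erase_eq_sub hi] at h2
    have h3 := Finset.sum_le_sum h1
    rw [← Finset.mul_sum, Finset.sum_sub_distrib, Finset.sum_const, Finset.sum_const, hc] at h3
    simp only [nsmul_eq_mul] at h3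
    push_cast at h3 ⊢
    have hj0 : (0 : ℝ) < j := by exact_mod_cast lt_of_lt_of_le hm hj
    refine le_of_mul_le_mul_left ?_ hj0
    nlinarith [h3]

lemma comb {ι : Type*} [DecidableEq ι] [Fintype ι] (a : ι → ℝ) (c : ℝ) (n k : ℕ) (hk : 1 < k)
    (hkn : k ≤ n) (hcard : Fintype.card ι = n) (i0 : ι)
    (h : ∀ s : Finset ι, s.card = k → i0 ∈ s → ∑ i ∈ s, a i ≤ c) :
    ((n : ℝ) - k) * a i0 + ((k : ℝ) - 1) * ∑ i, a i ≤ ((n : ℝ) - 1) * c := by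
  have hU : (Finset.univ.erase i0).card = n - 1 := by
    rw [Finset.card_erase_of_mem (Finset.mem_univ _), Finset.card_univ, hcard]
  have h1 := comb_aux a (c - a i0) (k - 1) (by omega) (Finset.univ.erase i0) (by
    intro t ht hc
    have hi : i0 ∉ t := fun hh => by simpa using ht hh
    have := h (insert i0 t) (by rw [Finset.card_insert_of_notMem hi, hc]; omega)
      (Finset.mem_insert_self _ _)
    rw [Finset.sum_insert hi] at this
    linarith) (n - 1) (by omega) _ (Finset.Subset.refl _) hU
  rw [Finset.sum_erase_eq_sub (Finset.mem_univ _), Nat.cast_sub (by omega),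
    Nat.cast_sub (by omega)] at h1
  push_cast at h1
  nlinarith [h1]

variable {V : Type*} [NormedAddCommGroup V] [InnerProductSpace ℂ V]

/-- Real bisectional quantity. -/
noncomputable def r (T : KahlerCurvature V) (X Y : V) : ℝ := (T.R X X Y Y).re

lemma sym_pair (T : KahlerCurvature V) (X Y Z W : V) : T.R X Y Z W = T.R Z W X Y := by
  rw [T.sym13, T.sym24]

lemma r_comm (T : KahlerCurvature V) (X Y : V) : T.r X Y = T.r Y X := by
  unfold r; rw [T.sym_pair]

lemma r_smul (T : KahlerCurvature V) (a : ℂ) (X Y : V) :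
    T.r (a • X) Y = ‖a‖ ^ 2 * T.r X Y := by
  unfold r
  rw [T.smul1, T.smul2, ← mul_assoc, Complex.mul_conj, Complex.normSq_eq_norm_sq,
    Complex.re_ofReal_mul]

lemma r_avg (T : KahlerCurvature V) (Z W U : V) :
    T.r (Z + (1 : ℂ) • W) U + T.r (Z + (-1 : ℂ) • W) U + T.r (Z + Complex.I • W) U
      + T.r (Z + (-Complex.I) • W) U = 4 * (T.r Z U + T.r W U) := by
  unfold r
  simp only [T.add1, T.add2, T.smul1, T.smul2]
  simp
  ring

lemma H_avg (T : KahlerCurvature V) (Z W : V) :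
    T.r (Z + (1 : ℂ) • W) (Z + (1 : ℂ) • W) + T.r (Z + (-1 : ℂ) • W) (Z + (-1 : ℂ) • W)
      + T.r (Z + Complex.I • W) (Z + Complex.I • W)
      + T.r (Z + (-Complex.I) • W) (Z + (-Complex.I) • W)
      = 4 * (T.r Z Z + T.r W W + 4 * T.r Z W) := by
  have e1 : T.R W W Z Z = T.R Z Z W W := T.sym_pair _ _ _ _
  have e2 : T.R Z W W Z = T.R Z Z W W := T.sym24 _ _ _ _
  have e3 : T.R W Z Z W = T.R Z Z W W := T.sym13 _ _ _ _
  unfold r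
  simp only [T.add1, T.add2, T.add3, T.add4, T.smul1, T.smul2, T.smul3, T.smul4, e1, e2, e3]
  simp
  ring

lemma phase (T : KahlerCurvature V) {ι κ : Type*} [DecidableEq ι] [Fintype κ] (e : κ → V)
    (v : ι → V) (a b c : ℝ) (s : Finset ι) : ∀ Z : V,
    (∀ ε : ι → ℂ, (∀ i, ‖ε i‖ = 1) →
      a * T.r (Z + ∑ i ∈ s, ε i • v i) (Z + ∑ i ∈ s, ε i • v i)
        + b * ∑ l, T.r (Z + ∑ i ∈ s, ε i • v i) (e l) ≤ c) →
    a * (T.r Z Z + 4 * ∑ i ∈ s, T.r Z (v i) + 2 * ∑ i ∈ s, ∑ j ∈ s, T.r (v i) (v j)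
        - ∑ i ∈ s, T.r (v i) (v i))
      + b * (∑ l, T.r Z (e l) + ∑ i ∈ s, ∑ l, T.r (v i) (e l)) ≤ c := by
  induction s using Finset.induction_on with
  | empty =>
    intro Z h
    simpa using h (fun _ => 1) (by simp)
  | insert x s hx ih =>
    intro Z h
    have key : ∀ η : ℂ, ‖η‖ = 1 → _ := fun η hη => ih (Z + η • v x) (by
      intro ε hε
      have := h (fun i => if i = x then η else ε i) (by intro i; split_ifs <;> simp [*])
      rw [Finset.sum_insert hx] at this
      have e1 : ∑ i ∈ s, (if i = x then η else ε i) • v i = ∑ i ∈ s, ε i • v i := by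
        refine Finset.sum_congr rfl fun i hi => ?_
        rw [if_neg]
        rintro rfl; exact hx hi
      simp only [e1, if_true, ← add_assoc] at this
      exact this)
    have k1 := key 1 (by simp)
    have k2 := key (-1) (by simp)
    have k3 := key Complex.I (by simp)
    have k4 := key (-Complex.I) (by simp)
    have hH := T.H_avg Z (v x)
    have hs : ∑ i ∈ s, T.r (Z + (1 : ℂ) • v x) (v i) + ∑ i ∈ s, T.r (Z + (-1 : ℂ) • v x) (v i)
        + ∑ i ∈ s, T.r (Z + Complex.I • v x) (v i) + ∑ i ∈ s, T.r (Z + (-Complex.I) • v x) (v i)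
        = 4 * (∑ i ∈ s, T.r Z (v i) + ∑ i ∈ s, T.r (v x) (v i)) := by
      simp only [← Finset.sum_add_distrib, Finset.mul_sum]
      exact Finset.sum_congr rfl fun i _ => T.r_avg _ _ _
    have hl : ∑ i, T.r (Z + (1 : ℂ) • v x) (e i) + ∑ i, T.r (Z + (-1 : ℂ) • v x) (e i)
        + ∑ i, T.r (Z + Complex.I • v x) (e i) + ∑ i, T.r (Z + (-Complex.I) • v x) (e i)
        = 4 * (∑ i, T.r Z (e i) + ∑ i, T.r (v x) (e i)) := by
      simp only [← Finset.sum_add_distrib, Finset.mul_sum]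
      exact Finset.sum_congr rfl fun i _ => T.r_avg _ _ _
    have hd : ∑ i ∈ insert x s, ∑ j ∈ insert x s, T.r (v i) (v j)
        = T.r (v x) (v x) + 2 * ∑ i ∈ s, T.r (v x) (v i) + ∑ i ∈ s, ∑ j ∈ s, T.r (v i) (v j) := by
      simp only [Finset.sum_insert hx, Finset.sum_add_distrib]
      rw [Finset.sum_congr rfl fun i _ => T.r_comm (v i) (v x)]
      ring
    rw [hd]
    simp only [Finset.sum_insert hx]
    have tot := add_le_add (add_le_add (add_le_add k1 k2) k3) k4
    have := congrArg (fun t => a * t) hH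
    have := congrArg (fun t => a * t) hs
    have := congrArg (fun t => b * t) hl
    linarith

lemma trace_indep {n : ℕ} (B : V → V → ℂ) (add1 : ∀ X Y Z, B (X + Y) Z = B X Z + B Y Z)
    (smul1 : ∀ (a : ℂ) X Y, B (a • X) Y = a * B X Y)
    (add2 : ∀ X Y Z, B X (Y + Z) = B X Y + B X Z)
    (smul2 : ∀ (a : ℂ) X Y, B X (a • Y) = (starRingEnd ℂ) a * B X Y)
    (e f : OrthonormalBasis (Fin n) ℂ V) : ∑ i, B (e i) (e i) = ∑ i, B (f i) (f i) := by
  have s1 : ∀ (s : Finset (Fin n)) (g : Fin n → V) Y, B (∑ i ∈ s, g i) Y = ∑ i ∈ s, B (g i) Y := by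
    intro s g Y
    exact map_sum (AddMonoidHom.mk' (fun X => B X Y) (fun X X' => add1 X X' Y)) g s
  have s2 : ∀ (s : Finset (Fin n)) (g : Fin n → V) Y, B Y (∑ i ∈ s, g i) = ∑ i ∈ s, B Y (g i) := by
    intro s g Y
    exact map_sum (AddMonoidHom.mk' (fun X => B Y X) (fun X X' => add2 Y X X')) g s
  have h : ∀ i, B (f i) (f i)
      = ∑ j, ∑ l, (inner ℂ (e j) (f i) * inner ℂ (f i) (e l)) * B (e j) (e l) := by
    intro i
    conv_lhs => rw [← e.sum_repr' (f i)]
    rw [s1]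
    refine Finset.sum_congr rfl fun j _ => ?_
    rw [s2]
    refine Finset.sum_congr rfl fun l _ => ?_
    rw [smul1, smul2, inner_conj_symm]
    ring
  simp only [h]
  rw [Finset.sum_comm]
  refine Finset.sum_congr rfl fun j _ => ?_
  rw [Finset.sum_comm]
  simp only [← Finset.sum_mul, f.sum_inner_mul_inner]
  simp [orthonormal_iff_ite.mp e.orthonormal]

lemma ric_indep {n : ℕ} (T : KahlerCurvature V) (e f : OrthonormalBasis (Fin n) ℂ V) (X : V) :
    ∑ i, T.r X (e i) = ∑ i, T.r X (f i) := by
  have := trace_indep (fun Y Z => T.R X X Y Z) (fun _ _ _ => T.add3 _ _ _ _ _)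
    (fun _ _ _ => T.smul3 _ _ _ _ _) (fun _ _ _ => T.add4 _ _ _ _ _)
    (fun _ _ _ => T.smul4 _ _ _ _ _) e f
  simpa [r] using congrArg Complex.re this

lemma scal_indep {n : ℕ} (T : KahlerCurvature V) (e f : OrthonormalBasis (Fin n) ℂ V) :
    ∑ i, ∑ j, T.r (e i) (e j) = ∑ i, ∑ j, T.r (f i) (f j) := by
  rw [Finset.sum_congr rfl fun i _ => T.ric_indep e f (e i), Finset.sum_comm,
    Finset.sum_congr rfl fun j _ => (Finset.sum_congr rfl fun i _ => T.r_comm (e i) (f j))]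
  exact Finset.sum_congr rfl fun i _ => T.ric_indep e f (f i)

lemma exists_basis [FiniteDimensional ℂ V] {n : ℕ} (hn : Module.finrank ℂ V = n) (i0 : Fin n)
    (Y : V) (hY : ‖Y‖ = 1) : ∃ b : OrthonormalBasis (Fin n) ℂ V, b i0 = Y := by
  obtain ⟨b, hb⟩ := Orthonormal.exists_orthonormalBasis_extension_of_card_eq (𝕜 := ℂ)
    (ι := Fin n) (by simpa using hn) (v := fun _ => Y) (s := {i0}) (by
      constructor
      · intro i; simpa using hY
      · intro i j hij; exact absurd (Subsingleton.elim i j) hij)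
  exact ⟨b, hb i0 rfl⟩

lemma unit_bound [FiniteDimensional ℂ V]
    (n k : ℕ) (hn : Module.finrank ℂ V = n) (hk1 : 1 < k) (hkn : k ≤ n)
    (σ : ℝ) (T : KahlerCurvature V)
    (e : OrthonormalBasis (Fin n) ℂ V)
    (hRick : ∀ P : Submodule ℂ V, Module.finrank ℂ P = k →
      ∀ f : OrthonormalBasis (Fin k) ℂ P, ∀ X ∈ P,
        (∑ j, T.R X X (f j : V) (f j : V)).re ≤ -((k : ℝ) + 1) * σ * ‖X‖ ^ 2)
    (Y : V) (hY : ‖Y‖ = 1) :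
    ((n : ℝ) - k) * T.r Y Y + ((k : ℝ) - 1) * ∑ i, T.r Y (e i)
      ≤ ((n : ℝ) - 1) * (-((k : ℝ) + 1) * σ) := by
  classical
  obtain ⟨b, hb⟩ := exists_basis hn ⟨0, by omega⟩ Y hY
  rw [T.ric_indep e b Y]
  have := comb (fun i => T.r Y (b i)) (-((k : ℝ) + 1) * σ) n k hk1 hkn (by simp) ⟨0, by omega⟩ (by
    intro s hs hi
    let f0 := OrthonormalBasis.span (𝕜 := ℂ) b.orthonormal s
    let f := f0.reindex (s.equivFinOfCardEq hs)
    have hfin : Module.finrank ℂ (Submodule.span ℂ (s.image b : Set V)) = k := by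
      rw [Module.finrank_eq_card_basis f.toBasis]; simp
    have h1 := hRick _ hfin f Y (Submodule.subset_span (by
      simp only [Finset.coe_image]
      exact ⟨_, hi, hb⟩))
    rw [hY] at h1
    have h2 : ∑ j, T.R Y Y (f j : V) (f j : V) = ∑ i ∈ s, T.R Y Y (b i) (b i) := by
      rw [← Finset.sum_coe_sort s, ← Equiv.sum_comp (s.equivFinOfCardEq hs)]
      refine Finset.sum_congr rfl fun i _ => ?_
      simp [f, f0, OrthonormalBasis.span_apply]
    rw [h2, Complex.re_sum] at h1
    simpa [r] using h1)
  rwa [hb] at this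

lemma r_smul2 (T : KahlerCurvature V) (a : ℂ) (X Y : V) :
    T.r X (a • Y) = ‖a‖ ^ 2 * T.r X Y := by
  rw [r_comm, r_smul, r_comm]

lemma hom_bound (T : KahlerCurvature V) {n : ℕ} (e : Fin n → V) (a b c : ℝ)
    (h : ∀ Y : V, ‖Y‖ = 1 → a * T.r Y Y + b * ∑ i, T.r Y (e i) ≤ c) (Y : V) (N : ℝ)
    (hN : 0 < N) (hY : ‖Y‖ ^ 2 = N) :
    a * T.r Y Y + b * N * ∑ i, T.r Y (e i) ≤ c * N ^ 2 := by
  have hY0 : ‖Y‖ ≠ 0 := by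
    intro h0; rw [h0] at hY; norm_num at hY; linarith
  have h1 := h (((‖Y‖⁻¹ : ℝ) : ℂ) • Y) (by
    rw [norm_smul]; simp [hY0])
  simp only [r_smul, r_smul2, ← Finset.mul_sum] at h1
  have h2 : ‖((‖Y‖⁻¹ : ℝ) : ℂ)‖ ^ 2 = N⁻¹ := by
    rw [← hY]; simp
  rw [h2] at h1
  have h3 := mul_le_mul_of_nonneg_right h1 (sq_nonneg N)
  have h4 : (a * (N⁻¹ * (N⁻¹ * T.r Y Y)) + b * (N⁻¹ * ∑ i, T.r Y (e i))) * N ^ 2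
    = a * T.r Y Y + b * N * ∑ i, T.r Y (e i) := by
    field_simp
  linarith

/-- Phase averaging with weights. -/
lemma weighted (T : KahlerCurvature V) {n : ℕ} (f : OrthonormalBasis (Fin n) ℂ V) (a b c : ℝ)
    (h : ∀ Y : V, ‖Y‖ = 1 → a * T.r Y Y + b * ∑ i, T.r Y (f i) ≤ c) (w : Fin n → ℝ)
    (hN : 0 < ∑ i, w i ^ 2) :
    a * (2 * ∑ i, ∑ j, w i ^ 2 * (w j ^ 2 * T.r (f i) (f j)) - ∑ i, w i ^ 2 * (w i ^ 2 * T.r (f i) (f i)))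
      + b * (∑ i, w i ^ 2) * ∑ i, w i ^ 2 * ∑ j, T.r (f i) (f j) ≤ c * (∑ i, w i ^ 2) ^ 2 := by
  have hz : ∀ U : V, T.r 0 U = 0 := fun U => by
    have := T.r_smul 0 0 U
    simpa using this
  have := T.phase f (fun i => (w i : ℂ) • f i) a (b * ∑ i, w i ^ 2) (c * (∑ i, w i ^ 2) ^ 2)
    Finset.univ 0 (by
      intro ε hε
      rw [zero_add]
      refine T.hom_bound f a b c h _ _ hN ?_
      simp only [smul_smul]
      rw [← f.sum_sq_norm_inner_right]
      simp only [f.orthonormal.inner_right_fintype]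
      simp [hε])
  simp only [hz, r_smul, r_smul2, Complex.norm_real, Real.norm_eq_abs, sq_abs,
    Finset.sum_const_zero, mul_zero, zero_add] at this
  simpa [Finset.mul_sum, mul_left_comm] using this

lemma unit_final [FiniteDimensional ℂ V]
    (n k : ℕ) (hn : Module.finrank ℂ V = n) (hk1 : 1 < k) (hkn : k ≤ n)
    (σ : ℝ) (T : KahlerCurvature V)
    (e : OrthonormalBasis (Fin n) ℂ V)
    (hRick : ∀ P : Submodule ℂ V, Module.finrank ℂ P = k →
      ∀ f : OrthonormalBasis (Fin k) ℂ P, ∀ X ∈ P,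
        (∑ j, T.R X X (f j : V) (f j : V)).re ≤ -((k : ℝ) + 1) * σ * ‖X‖ ^ 2)
    (X : V) (hX : ‖X‖ = 1) :
    ((n : ℝ) * k + n - k - 2) * (∑ i, ∑ j, T.r (e i) (e j)) + n * ∑ i, T.r X (e i)
      ≤ -((n : ℝ) * ((n : ℝ) + 1) * ((n : ℝ) - 1) * ((k : ℝ) + 1) * σ) := by
  have hnpos : 0 < n := by omega
  obtain ⟨f, hf⟩ := exists_basis hn ⟨0, hnpos⟩ X hX
  set i0 : Fin n := ⟨0, hnpos⟩
  rw [T.scal_indep e f, T.ric_indep e f X]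
  have hu := unit_bound n k hn hk1 hkn σ T f hRick
  have hb := Finset.sum_le_sum (fun i (_ : i ∈ Finset.univ) => hu (f i) (f.orthonormal.1 i))
  rw [Finset.sum_add_distrib, ← Finset.mul_sum, ← Finset.mul_sum] at hb
  have h1 := T.weighted f _ _ _ hu (fun _ => 1) (by simp [hnpos])
  have hw : ∀ i, (if i = i0 then Real.sqrt 3 else 1) ^ 2 = 1 + (if i = i0 then (2 : ℝ) else 0) := by
    intro i; split_ifs <;> norm_num
  have h2 := T.weighted f _ _ _ hu (fun i => if i = i0 then Real.sqrt 3 else 1) (by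
    simp only [hw]
    refine Finset.sum_pos (fun i _ => by split_ifs <;> norm_num) ⟨i0, Finset.mem_univ _⟩)
  simp only [hw] at h2
  simp [add_mul, mul_add, Finset.sum_add_distrib, ite_mul, mul_ite, Finset.sum_ite_eq'] at h1 h2 hb
  have hsym : ∑ i, T.r (f i) (f i0) = ∑ i, T.r X (f i) := by
    rw [← hf]; exact Finset.sum_congr rfl fun i _ => T.r_comm _ _
  rw [hf] at hsym
  simp only [← Finset.mul_sum, hf, hsym] at h1 h2 hb
  generalize ∑ i, ∑ j, T.r (f i) (f j) = S at *
  generalize ∑ i, T.r (f i) (f i) = D at *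
  generalize ∑ i, T.r X (f i) = ρ at *
  generalize T.r X X = H at *
  have hk2 : (2 : ℝ) ≤ k := by exact_mod_cast hk1
  have hkn' : (k : ℝ) ≤ n := by exact_mod_cast hkn
  generalize (n : ℝ) = N at *
  generalize (k : ℝ) = K at *
  clear hu hw hRick hsym
  have hS : S + N * (N + 1) * σ ≤ 0 := by
    have hp : 0 < (N - 1) * (K + 1) := mul_pos (by linarith) (by linarith)
    refine le_of_mul_le_mul_left ?_ hp
    linarith
  have hI : (K * N + N + K - 3) * (S + N * (N + 1) * σ)
      + 2 * (K * N + 3 * N - 2 * K - 2) * (ρ + (N + 1) * σ) ≤ 0 := by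
    linarith
  have hKN : 2 * N ≤ K * N := mul_le_mul_of_nonneg_right hk2 (by linarith)
  have hKN' : 0 ≤ (K - 2) * (N - 2) := mul_nonneg (by linarith) (by linarith)
  have hM : N ≤ N * K + N - K - 2 := by nlinarith
  have hQ : 0 < K * N + 3 * N - 2 * K - 2 := by nlinarith
  have hP : 0 ≤ K * N + N + K - 3 := by nlinarith
  have hPQ : K * N + N + K - 3 ≤ 2 * (K * N + 3 * N - 2 * K - 2) := by nlinarith
  have hMP : N * (K * N + N + K - 3)
      ≤ (N * K + N - K - 2) * (2 * (K * N + 3 * N - 2 * K - 2)) :=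
    mul_le_mul hM hPQ hP (by linarith)
  have hA := mul_le_mul_of_nonneg_left hI (by linarith : (0 : ℝ) ≤ N)
  have hB := mul_nonneg (sub_nonneg.mpr hMP) (neg_nonneg.mpr hS)
  have hG : (N * K + N - K - 2) * (S + N * (N + 1) * σ) + N * (ρ + (N + 1) * σ) ≤ 0 := by
    refine le_of_mul_le_mul_left ?_ (by linarith : 0 < 2 * (K * N + 3 * N - 2 * K - 2))
    linarith
  linarith

end KahlerCurvature

/-- Lemma 3 (Chu–Lee–Tam): if `Ric_k(Σ)(X,X̄) ≤ -(k+1)σ|X|²` for every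
`k`-dimensional complex subspace `Σ` and every `X ∈ Σ` (`1 < k ≤ n`), then
`(nk + n - k - 2) S |X|² + n Ric(X,X̄) ≤ -n(n+1)(n-1)(k+1)σ |X|²`,
where `S` is the scalar curvature. -/
theorem stmt2 {V : Type*} [NormedAddCommGroup V] [InnerProductSpace ℂ V]
    [FiniteDimensional ℂ V]
    (n k : ℕ) (hn : Module.finrank ℂ V = n) (hk1 : 1 < k) (hkn : k ≤ n)
    (σ : ℝ) (T : KahlerCurvature V)
    (e : OrthonormalBasis (Fin n) ℂ V)
    (hRick : ∀ P : Submodule ℂ V, Module.finrank ℂ P = k →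
      ∀ f : OrthonormalBasis (Fin k) ℂ P, ∀ X ∈ P,
        (∑ j, T.R X X (f j : V) (f j : V)).re ≤ -((k : ℝ) + 1) * σ * ‖X‖ ^ 2) :
    ∀ X : V,
      ((n : ℝ) * (k : ℝ) + (n : ℝ) - (k : ℝ) - 2)
            * (∑ i, ∑ j, T.R (e i) (e i) (e j) (e j)).re * ‖X‖ ^ 2
          + (n : ℝ) * (∑ i, T.R X X (e i) (e i)).re
        ≤ -((n : ℝ) * ((n : ℝ) + 1) * ((n : ℝ) - 1) * ((k : ℝ) + 1) * σ)
            * ‖X‖ ^ 2 := by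
  classical
  intro X
  have key := KahlerCurvature.unit_final n k hn hk1 hkn σ T e hRick
  by_cases hX : X = 0
  · have h0 : ∀ U : V, T.R 0 0 U U = 0 := fun U => by
      have := T.smul1 0 0 0 U U
      simpa using this
    simp [hX, h0]
  · have hX0 : ‖X‖ ≠ 0 := by simpa using hX
    have h1 := key (((‖X‖⁻¹ : ℝ) : ℂ) • X) (by rw [norm_smul]; simp [hX0])
    simp only [KahlerCurvature.r_smul, ← Finset.mul_sum] at h1
    have h2 : ‖((‖X‖⁻¹ : ℝ) : ℂ)‖ ^ 2 = (‖X‖ ^ 2)⁻¹ := by simp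
    rw [h2] at h1
    have h3 := mul_le_mul_of_nonneg_right h1 (sq_nonneg ‖X‖)
    simp only [Complex.re_sum]
    simp only [KahlerCurvature.r] at h3
    refine le_trans (le_of_eq ?_) h3
    field_simp
end

section
/- Let V be an n-dimensional complex inner product space, let k be an integer with 1 < k ≤ n, let σ be a real number, and let R be a Kähler-type curvature tensor on V. Suppose that for every k-dimensional complex subspace Σ of V and every X ∈ Σ one has Ric_k(Σ)(X,X̄) ≤ −(k+1)σ|X|². Then the scalar curvature satisfies S ≤ −n(n+1)σ, where S = Σᵢ Ric(eᵢ,ēᵢ) (sum over an orthonormal basis (eᵢ) of V). -/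
open Finset in
/-- averaging lemma: sums over `p`-subsets bounded by `D` -/
theorem aux_avg {ι : Type*} [DecidableEq ι] (r : ι → ℝ) (p : ℕ) (D : ℝ) (hp : 1 ≤ p) :
    ∀ (d : ℕ) (s : Finset ι), s.card = p + d →
      (∀ t ⊆ s, t.card = p → ∑ i ∈ t, r i ≤ D) →
      (p : ℝ) * ∑ i ∈ s, r i ≤ ((p + d : ℕ) : ℝ) * D := by
  intro d
  induction d with
  | zero =>
    intro s hs h
    have := h s (Finset.Subset.refl s) (by simpa using hs)
    simp only [add_zero]
    gcongr
  | succ d ih =>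
    intro s hs h
    have h1 : ∀ i ∈ s, (p : ℝ) * (∑ j ∈ s, r j - r i) ≤ ((p + d : ℕ) : ℝ) * D := by
      intro i hi
      have h2 := ih (s.erase i) (by rw [Finset.card_erase_of_mem hi, hs]; omega)
        (fun t ht hc => h t (ht.trans (Finset.erase_subset i s)) hc)
      have h3 := Finset.add_sum_erase s r hi
      have h4 : ∑ j ∈ s, r j - r i = ∑ j ∈ s.erase i, r j := by linarith
      rw [h4]; exact h2
    have h5 := Finset.sum_le_sum h1
    rw [← Finset.mul_sum, Finset.sum_sub_distrib] at h5
    simp only [Finset.sum_const, nsmul_eq_mul, hs] at h5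
    have hq : (0:ℝ) < ((p + d : ℕ) : ℝ) := by
      have : 0 < p + d := by omega
      exact_mod_cast this
    refine le_of_mul_le_mul_left ?_ hq
    push_cast at h5 ⊢
    nlinarith [h5]

theorem aux_sidon (a b c d : ℕ) (h : 4 ^ a + 4 ^ c = 4 ^ b + 4 ^ d) :
    (a = b ∧ c = d) ∨ (a = d ∧ b = c) := by
  have key : ∀ a b c d : ℕ, c ≤ a → d ≤ b → 4 ^ a + 4 ^ c = 4 ^ b + 4 ^ d → a ≤ b := by
    intro a b c d hca hdb h
    by_contra hlt
    push Not at hlt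
    have h1 : 4 ^ (b + 1) ≤ 4 ^ a := Nat.pow_le_pow_right (by norm_num) hlt
    have h2 : 4 ^ d ≤ 4 ^ b := Nat.pow_le_pow_right (by norm_num) hdb
    have h3 : 0 < 4 ^ b := by positivity
    have h4 : 0 < 4 ^ c := by positivity
    rw [pow_succ] at h1
    omega
  have key2 : ∀ a b c d : ℕ, c ≤ a → d ≤ b → 4 ^ a + 4 ^ c = 4 ^ b + 4 ^ d →
      a = b ∧ c = d := by
    intro a b c d hca hdb h
    have hab := le_antisymm (key a b c d hca hdb h) (key b a d c hdb hca h.symm)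
    subst hab
    refine ⟨rfl, Nat.pow_right_injective (le_refl 2 |>.trans (by norm_num : 2 ≤ 4)) ?_⟩
    simpa using h
  rcases le_total c a with h1 | h1 <;> rcases le_total d b with h2 | h2
  · exact Or.inl (key2 _ _ _ _ h1 h2 h)
  · have := key2 a d c b h1 h2 (by omega)
    exact Or.inr ⟨this.1, this.2.symm⟩
  · have := key2 c b a d h1 h2 (by omega)
    exact Or.inr ⟨this.2, this.1.symm⟩
  · have := key2 c d a b h1 h2 (by omega)
    exact Or.inl ⟨this.2, this.1⟩

theorem aux_root (N : ℕ) (hN : N ≠ 0) : ∃ z : ℂ, IsPrimitiveRoot z N ∧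
    z * (starRingEnd ℂ) z = 1 := by
  refine ⟨_, Complex.isPrimitiveRoot_exp N hN, ?_⟩
  rw [Complex.mul_conj, Complex.normSq_eq_norm_sq,
    (Complex.isPrimitiveRoot_exp N hN).norm'_eq_one hN]
  simp

theorem aux_geom (N : ℕ) (hN : N ≠ 0) (z : ℂ) (hz : IsPrimitiveRoot z N)
    (hz1 : z * (starRingEnd ℂ) z = 1) (p q : ℕ) (hp : p < N) (hq : q < N) :
    ∑ m ∈ Finset.range N, (z ^ m) ^ p * (starRingEnd ℂ) ((z ^ m) ^ q)
      = if p = q then (N : ℂ) else 0 := by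
  set w : ℂ := z ^ p * (starRingEnd ℂ) (z ^ q) with hw
  have e1 : ∀ m, (z ^ m) ^ p * (starRingEnd ℂ) ((z ^ m) ^ q) = w ^ m := by
    intro m
    rw [hw, mul_pow, ← map_pow, ← pow_mul, ← pow_mul, ← pow_mul, ← pow_mul, mul_comm m p,
      mul_comm m q]
  simp only [e1]
  have hqq : z ^ q * (starRingEnd ℂ) (z ^ q) = 1 := by
    rw [map_pow, ← mul_pow, hz1, one_pow]
  split_ifs with h
  · have : w = 1 := by rw [hw, h, hqq]
    simp [this]
  · have hw1 : w ≠ 1 := by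
      intro h1
      apply h
      apply hz.pow_inj hp hq
      calc z ^ p = z ^ p * (z ^ q * (starRingEnd ℂ) (z ^ q)) := by rw [hqq, mul_one]
        _ = w * z ^ q := by rw [hw]; ring
        _ = z ^ q := by rw [h1, one_mul]
    have hwN : w ^ N = 1 := by
      rw [hw, mul_pow, ← map_pow, ← pow_mul, ← pow_mul, mul_comm p, mul_comm q, pow_mul, pow_mul,
        hz.pow_eq_one]
      simp
    have := geom_sum_eq hw1 N
    rw [this, hwN]; simp

namespace KahlerCurvature

variable {V : Type*} [AddCommGroup V] [Module ℂ V] (T : KahlerCurvature V)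

theorem sum1 {ι : Type*} (s : Finset ι) (g : ι → V) (Y Z W : V) :
    T.R (∑ i ∈ s, g i) Y Z W = ∑ i ∈ s, T.R (g i) Y Z W := by
  classical
  induction s using Finset.induction_on with
  | empty => simpa using T.smul1 0 0 Y Z W
  | insert a s ha ih => rw [Finset.sum_insert ha, Finset.sum_insert ha, T.add1, ih]

theorem sum2 {ι : Type*} (s : Finset ι) (g : ι → V) (X Z W : V) :
    T.R X (∑ i ∈ s, g i) Z W = ∑ i ∈ s, T.R X (g i) Z W := by
  classical
  induction s using Finset.induction_on with
  | empty => simpa using T.smul2 0 X 0 Z W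
  | insert a s ha ih => rw [Finset.sum_insert ha, Finset.sum_insert ha, T.add2, ih]

theorem sum3 {ι : Type*} (s : Finset ι) (g : ι → V) (X Y W : V) :
    T.R X Y (∑ i ∈ s, g i) W = ∑ i ∈ s, T.R X Y (g i) W := by
  rw [T.sym13, T.sum1]; exact Finset.sum_congr rfl fun i _ => T.sym13 _ _ _ _

theorem sum4 {ι : Type*} (s : Finset ι) (g : ι → V) (X Y Z : V) :
    T.R X Y Z (∑ i ∈ s, g i) = ∑ i ∈ s, T.R X Y Z (g i) := by
  rw [T.sym24, T.sum2]; exact Finset.sum_congr rfl fun i _ => T.sym24 _ _ _ _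

/-- expansion in the first two slots -/
theorem expand12 {ι : Type*} (s : Finset ι) (x : ι → ℂ) (g : ι → V) (Z W : V) :
    T.R (∑ i ∈ s, x i • g i) (∑ i ∈ s, x i • g i) Z W
      = ∑ a ∈ s, ∑ b ∈ s, x a * (starRingEnd ℂ) (x b) * T.R (g a) (g b) Z W := by
  rw [T.sum1]
  refine Finset.sum_congr rfl fun a _ => ?_
  rw [T.sum2]
  refine Finset.sum_congr rfl fun b _ => ?_
  rw [T.smul1, T.smul2]; ring

theorem expand34 {ι : Type*} (s : Finset ι) (x : ι → ℂ) (g : ι → V) (Z W : V) :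
    T.R Z W (∑ i ∈ s, x i • g i) (∑ i ∈ s, x i • g i)
      = ∑ a ∈ s, ∑ b ∈ s, x a * (starRingEnd ℂ) (x b) * T.R Z W (g a) (g b) := by
  rw [T.sum3]
  refine Finset.sum_congr rfl fun a _ => ?_
  rw [T.sum4]
  refine Finset.sum_congr rfl fun b _ => ?_
  rw [T.smul3, T.smul4]; ring

end KahlerCurvature

theorem aux_indep {V : Type*} [NormedAddCommGroup V] [InnerProductSpace ℂ V]
    {n : ℕ} (T : KahlerCurvature V) (e f : OrthonormalBasis (Fin n) ℂ V) (X Y : V) :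
    ∑ j, T.R X Y (f j) (f j) = ∑ j, T.R X Y (e j) (e j) := by
  have h1 : ∀ j, T.R X Y (f j) (f j) = ∑ a, ∑ b,
      inner ℂ (e a) (f j) * inner ℂ (f j) (e b) * T.R X Y (e a) (e b) := by
    intro j
    conv_lhs => rw [← e.sum_repr' (f j)]
    rw [T.expand34]
    simp
  simp only [h1]
  rw [Finset.sum_comm]
  refine Finset.sum_congr rfl fun a _ => ?_
  rw [Finset.sum_comm]
  simp only [← Finset.sum_mul, f.sum_inner_mul_inner]
  simp [e.inner_eq_ite]

/-- The estimate for unit vectors. -/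
theorem aux_unit {V : Type*} [NormedAddCommGroup V] [InnerProductSpace ℂ V]
    [FiniteDimensional ℂ V]
    (n k : ℕ) (hn : Module.finrank ℂ V = n) (hk1 : 1 < k) (hkn : k ≤ n)
    (σ : ℝ) (T : KahlerCurvature V)
    (e : OrthonormalBasis (Fin n) ℂ V)
    (hRick : ∀ P : Submodule ℂ V, Module.finrank ℂ P = k →
      ∀ f : OrthonormalBasis (Fin k) ℂ P, ∀ X ∈ P,
        (∑ j, T.R X X (f j : V) (f j : V)).re ≤ -((k : ℝ) + 1) * σ * ‖X‖ ^ 2)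
    (X : V) (hX : ‖X‖ = 1) :
    ((n : ℝ) - k) * (T.R X X X X).re + ((k : ℝ) - 1) * (∑ j, T.R X X (e j) (e j)).re
      ≤ -((n : ℝ) - 1) * ((k : ℝ) + 1) * σ := by
  have hn0 : 0 < n := by omega
  let i0 : Fin n := ⟨0, hn0⟩
  obtain ⟨f, hf⟩ := Orthonormal.exists_orthonormalBasis_extension_of_card_eq (𝕜 := ℂ)
    (ι := Fin n) (by simpa using hn) (v := fun _ => X) (s := {i0}) (by
      rw [orthonormal_iff_ite]
      intro i j
      have : i = j := Subsingleton.elim _ _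
      simp [this, inner_self_eq_norm_sq_to_K, hX])
  have hf0 : f i0 = X := hf i0 rfl
  rw [← aux_indep T e f]
  have hsub : ∀ s : Finset (Fin n), i0 ∈ s → s.card = k →
      ∑ j ∈ s, (T.R X X (f j) (f j)).re ≤ -((k : ℝ) + 1) * σ := by
    intro s hs hc
    classical
    let g := OrthonormalBasis.span f.orthonormal s
    let g' := g.reindex (s.equivFinOfCardEq hc)
    have h1 := hRick _ (by rw [Module.finrank_eq_card_basis g'.toBasis]; simp) g' X (by
      rw [← hf0]
      exact Submodule.subset_span (by simpa using ⟨i0, hs, rfl⟩))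
    have h2 : ∑ j, T.R X X (g' j : V) (g' j : V) = ∑ j ∈ s, T.R X X (f j) (f j) := by
      rw [← Finset.sum_coe_sort s]
      rw [← (s.equivFinOfCardEq hc).sum_comp]
      refine Finset.sum_congr rfl fun i _ => ?_
      simp [g', g, OrthonormalBasis.span_apply]
    rw [h2, hX, Complex.re_sum] at h1
    simpa using h1
  have h3 := aux_avg (fun j => (T.R X X (f j) (f j)).re) (k - 1)
    (-((k : ℝ) + 1) * σ - (T.R X X X X).re) (by omega) (n - k) (Finset.univ.erase i0)
    (by rw [Finset.card_erase_of_mem (Finset.mem_univ _)]; simp; omega) (by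
      intro t ht hc
      have hni : i0 ∉ t := fun h => by simpa using ht h
      have := hsub (insert i0 t) (Finset.mem_insert_self _ _)
        (by rw [Finset.card_insert_of_notMem hni]; omega)
      rw [Finset.sum_insert hni, hf0] at this
      linarith)
  have h4 := Finset.add_sum_erase Finset.univ (fun j => (T.R X X (f j) (f j)).re)
    (Finset.mem_univ i0)
  simp only [hf0] at h4
  rw [Complex.re_sum, ← h4]
  have e1 : k - 1 + (n - k) = n - 1 := by omega
  rw [e1, Nat.cast_sub (by omega), Nat.cast_sub (by omega)] at h3
  push_cast at h3
  nlinarith [h3]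

theorem aux_all {V : Type*} [NormedAddCommGroup V] [InnerProductSpace ℂ V]
    [FiniteDimensional ℂ V]
    (n k : ℕ) (hn : Module.finrank ℂ V = n) (hk1 : 1 < k) (hkn : k ≤ n)
    (σ : ℝ) (T : KahlerCurvature V)
    (e : OrthonormalBasis (Fin n) ℂ V)
    (hRick : ∀ P : Submodule ℂ V, Module.finrank ℂ P = k →
      ∀ f : OrthonormalBasis (Fin k) ℂ P, ∀ X ∈ P,
        (∑ j, T.R X X (f j : V) (f j : V)).re ≤ -((k : ℝ) + 1) * σ * ‖X‖ ^ 2)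
    (X : V) (hX : ‖X‖ ^ 2 = n) :
    ((n : ℝ) - k) * (T.R X X X X).re + ((k : ℝ) - 1) * n * (∑ j, T.R X X (e j) (e j)).re
      ≤ -((n : ℝ) - 1) * ((k : ℝ) + 1) * σ * n ^ 2 := by
  have hn0 : (0:ℝ) < n := by
    have : 0 < n := by omega
    exact_mod_cast this
  have hXn : ‖X‖ ≠ 0 := by
    intro h; rw [h] at hX; simp at hX; linarith
  obtain ⟨U, hU, hXU⟩ : ∃ U : V, ‖U‖ = 1 ∧ X = ((‖X‖ : ℝ) : ℂ) • U := by
    refine ⟨((‖X‖⁻¹ : ℝ) : ℂ) • X, ?_, ?_⟩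
    · rw [norm_smul]; simp [hXn]
    · rw [smul_smul, ← Complex.ofReal_mul, mul_inv_cancel₀ hXn]; simp
  have h := aux_unit n k hn hk1 hkn σ T e hRick U hU
  set c := ‖X‖
  have h1 : ∀ Z W, T.R X X Z W = ((n : ℝ) : ℂ) * T.R U U Z W := by
    intro Z W
    rw [hXU, T.smul1, T.smul2, ← hX]
    push_cast
    rw [Complex.conj_ofReal]; ring
  have h2 : T.R X X X X = ((n ^ 2 : ℝ) : ℂ) * T.R U U U U := by
    have : T.R U U X X = T.R X X U U := by rw [T.sym13, T.sym24]
    rw [h1, this, h1]; push_cast; ring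
  rw [h2]
  simp only [h1]
  rw [← Finset.mul_sum, Complex.re_ofReal_mul, Complex.re_ofReal_mul]
  have := mul_le_mul_of_nonneg_left h (by positivity : (0:ℝ) ≤ (n:ℝ) ^ 2)
  nlinarith [this]

/-- If `Ric_k(Σ)(X,X̄) ≤ -(k+1)σ|X|²` for every `k`-dimensional complex
subspace `Σ` and every `X ∈ Σ` (`1 < k ≤ n`), then the scalar curvature
satisfies `S ≤ -n(n+1)σ`. -/
theorem stmt3 {V : Type*} [NormedAddCommGroup V] [InnerProductSpace ℂ V]
    [FiniteDimensional ℂ V]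
    (n k : ℕ) (hn : Module.finrank ℂ V = n) (hk1 : 1 < k) (hkn : k ≤ n)
    (σ : ℝ) (T : KahlerCurvature V)
    (e : OrthonormalBasis (Fin n) ℂ V)
    (hRick : ∀ P : Submodule ℂ V, Module.finrank ℂ P = k →
      ∀ f : OrthonormalBasis (Fin k) ℂ P, ∀ X ∈ P,
        (∑ j, T.R X X (f j : V) (f j : V)).re ≤ -((k : ℝ) + 1) * σ * ‖X‖ ^ 2) :
    (∑ i, ∑ j, T.R (e i) (e i) (e j) (e j)).re
      ≤ -((n : ℝ) * ((n : ℝ) + 1) * σ) := by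
  classical
  set N : ℕ := 2 * 4 ^ n with hN
  have hN0 : N ≠ 0 := by positivity
  obtain ⟨z, hz, hz1⟩ := aux_root N hN0
  let x : ℕ → Fin n → ℂ := fun m j => (z ^ m) ^ (4 ^ (j : ℕ))
  let X : ℕ → V := fun m => ∑ j, x m j • e j
  have hlt : ∀ a : Fin n, 4 ^ (a : ℕ) < 4 ^ n := fun a =>
    Nat.pow_lt_pow_right (by norm_num) a.2
  have hx1 : ∀ m j, ‖x m j‖ = 1 := by
    intro m j
    simp [x, hz.norm'_eq_one hN0]
  have hXn : ∀ m, ‖X m‖ ^ 2 = n := by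
    intro m
    have h1 := e.sum_sq_norm_inner_right (X m)
    rw [← h1]
    have h2 : ∀ i, inner ℂ (e i) (X m) = x m i := by
      intro i
      simp [X, inner_sum, inner_smul_right, e.inner_eq_ite]
    simp [h2, hx1]
  set S : ℂ := ∑ i, ∑ j, T.R (e i) (e i) (e j) (e j) with hS
  set A : ℂ := ∑ i, T.R (e i) (e i) (e i) (e i) with hA
  have hRic : ∑ m ∈ Finset.range N, ∑ j, T.R (X m) (X m) (e j) (e j) = N * S := by
    have h1 : ∀ m j, T.R (X m) (X m) (e j) (e j) = ∑ a, ∑ b,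
        x m a * (starRingEnd ℂ) (x m b) * T.R (e a) (e b) (e j) (e j) := fun m j =>
      T.expand12 _ _ _ _ _
    have h2 : ∀ a b : Fin n, ∑ m ∈ Finset.range N, x m a * (starRingEnd ℂ) (x m b)
        = if a = b then (N : ℂ) else 0 := by
      intro a b
      have ha := hlt a
      have hb := hlt b
      rw [aux_geom N hN0 z hz hz1 _ _ (by omega) (by omega)]
      have : (4 ^ (a : ℕ) = 4 ^ (b : ℕ)) ↔ a = b := by
        rw [Fin.ext_iff]
        exact (Nat.pow_right_injective (by norm_num : 2 ≤ 4)).eq_iff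
      simp only [this]
    calc _ = ∑ j, ∑ a, ∑ b, (∑ m ∈ Finset.range N, x m a * (starRingEnd ℂ) (x m b)) *
            T.R (e a) (e b) (e j) (e j) := by
          simp only [h1]
          rw [Finset.sum_comm]
          refine Finset.sum_congr rfl fun j _ => ?_
          rw [Finset.sum_comm]
          refine Finset.sum_congr rfl fun a _ => ?_
          rw [Finset.sum_comm]
          refine Finset.sum_congr rfl fun b _ => ?_
          rw [Finset.sum_mul]
      _ = N * S := by
          simp only [h2, ite_mul, zero_mul, Finset.sum_ite_eq, Finset.mem_univ, if_true]
          rw [hS, Finset.mul_sum, Finset.sum_comm]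
          simp only [Finset.mul_sum]
  have hH : ∑ m ∈ Finset.range N, T.R (X m) (X m) (X m) (X m) = N * (2 * S - A) := by
    have h1 : ∀ m, T.R (X m) (X m) (X m) (X m) = ∑ a, ∑ b, ∑ c, ∑ d,
        x m a * (starRingEnd ℂ) (x m b) * (x m c * (starRingEnd ℂ) (x m d)) *
          T.R (e a) (e b) (e c) (e d) := by
      intro m
      rw [show T.R (X m) (X m) (X m) (X m) = _ from T.expand12 _ _ _ _ _]
      refine Finset.sum_congr rfl fun a _ => Finset.sum_congr rfl fun b _ => ?_
      rw [show T.R (e a) (e b) (X m) (X m) = _ from T.expand34 _ _ _ _ _]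
      simp only [Finset.mul_sum]
      refine Finset.sum_congr rfl fun c _ => Finset.sum_congr rfl fun d _ => ?_
      ring
    have h2 : ∀ a b c d : Fin n, ∑ m ∈ Finset.range N,
        x m a * (starRingEnd ℂ) (x m b) * (x m c * (starRingEnd ℂ) (x m d))
        = N * ((if a = b then (if c = d then 1 else 0) else 0)
          + (if a = d then (if b = c then 1 else 0) else 0)
          - (if a = b then (if b = c then (if c = d then 1 else 0) else 0) else 0)) := by
      intro a b c d
      have ha := hlt a
      have hb := hlt b
      have hc := hlt c
      have hd := hlt d
      have h3 := aux_geom N hN0 z hz hz1 (4 ^ (a : ℕ) + 4 ^ (c : ℕ)) (4 ^ (b : ℕ) + 4 ^ (d : ℕ))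
        (by omega) (by omega)
      have h4 : (4 ^ (a : ℕ) + 4 ^ (c : ℕ) = 4 ^ (b : ℕ) + 4 ^ (d : ℕ)) ↔
          ((a = b ∧ c = d) ∨ (a = d ∧ b = c)) := by
        constructor
        · intro h
          simpa [Fin.ext_iff] using aux_sidon _ _ _ _ h
        · rintro (⟨rfl, rfl⟩ | ⟨rfl, rfl⟩)
          · rfl
          · exact add_comm _ _
      calc _ = _ := by
            refine Finset.sum_congr rfl fun m _ => ?_
            change (z ^ m) ^ (4 ^ (a : ℕ)) * (starRingEnd ℂ) ((z ^ m) ^ (4 ^ (b : ℕ))) *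
              ((z ^ m) ^ (4 ^ (c : ℕ)) * (starRingEnd ℂ) ((z ^ m) ^ (4 ^ (d : ℕ)))) =
              (z ^ m) ^ (4 ^ (a : ℕ) + 4 ^ (c : ℕ)) *
                (starRingEnd ℂ) ((z ^ m) ^ (4 ^ (b : ℕ) + 4 ^ (d : ℕ)))
            rw [pow_add (z ^ m), pow_add (z ^ m), map_mul]; ring
        _ = _ := h3
        _ = _ := by
            simp only [h4]
            by_cases p1 : a = b <;> by_cases p2 : c = d <;> by_cases p3 : a = d <;>
              by_cases p4 : b = c <;> simp_all
    calc _ = ∑ a, ∑ b, ∑ c, ∑ d, (∑ m ∈ Finset.range N,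
            x m a * (starRingEnd ℂ) (x m b) * (x m c * (starRingEnd ℂ) (x m d))) *
            T.R (e a) (e b) (e c) (e d) := by
          simp only [h1]
          rw [Finset.sum_comm]
          refine Finset.sum_congr rfl fun a _ => ?_
          rw [Finset.sum_comm]
          refine Finset.sum_congr rfl fun b _ => ?_
          rw [Finset.sum_comm]
          refine Finset.sum_congr rfl fun c _ => ?_
          rw [Finset.sum_comm]
          refine Finset.sum_congr rfl fun d _ => ?_
          rw [Finset.sum_mul]
      _ = N * ∑ a, ∑ b, ∑ c, ∑ d,
          ((if a = b then (if c = d then T.R (e a) (e b) (e c) (e d) else 0) else 0)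
          + (if a = d then (if b = c then T.R (e a) (e b) (e c) (e d) else 0) else 0)
          - (if a = b then (if b = c then (if c = d then T.R (e a) (e b) (e c) (e d)
              else 0) else 0) else 0)) := by
          simp only [h2, Finset.mul_sum]
          refine Finset.sum_congr rfl fun a _ => Finset.sum_congr rfl fun b _ =>
            Finset.sum_congr rfl fun c _ => Finset.sum_congr rfl fun d _ => ?_
          rw [mul_assoc, sub_mul, add_mul]
          simp only [ite_mul, one_mul, zero_mul]
      _ = N * (2 * S - A) := by
          congr 1
          simp only [Finset.sum_sub_distrib, Finset.sum_add_distrib]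
          have t1 : ∑ a, ∑ b, ∑ c, ∑ d, (if a = b then
              (if c = d then T.R (e a) (e b) (e c) (e d) else 0) else 0) = S := by
            rw [hS]
            refine Finset.sum_congr rfl fun a _ => ?_
            rw [Finset.sum_eq_single a (fun b _ hb => by simp [hb.symm]) (by simp)]
            simp
          have t2 : ∑ a, ∑ b, ∑ c, ∑ d, (if a = d then
              (if b = c then T.R (e a) (e b) (e c) (e d) else 0) else 0) = S := by
            rw [hS]
            refine Finset.sum_congr rfl fun a _ => Finset.sum_congr rfl fun b _ => ?_
            simp only [Finset.sum_ite_eq, Finset.mem_univ, if_true]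
            exact T.sym24 _ _ _ _
          have t3 : ∑ a, ∑ b, ∑ c, ∑ d, (if a = b then (if b = c then
              (if c = d then T.R (e a) (e b) (e c) (e d) else 0) else 0) else 0) = A := by
            rw [hA]
            refine Finset.sum_congr rfl fun a _ => ?_
            rw [Finset.sum_eq_single a (fun b _ hb => by simp [hb.symm]) (by simp)]
            simp
          rw [t1, t2, t3]; ring
  have hNpos : (0 : ℝ) < N := by positivity
  have hsumX := Finset.sum_le_sum (s := Finset.range N) fun m _ =>
    aux_all n k hn hk1 hkn σ T e hRick (X m) (hXn m)
  rw [Finset.sum_add_distrib, ← Finset.mul_sum, ← Finset.mul_sum, ← Complex.re_sum,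
    ← Complex.re_sum, hRic, hH] at hsumX
  have hsumE := Finset.sum_le_sum (s := Finset.univ) fun i _ =>
    aux_unit n k hn hk1 hkn σ T e hRick (e i) (e.orthonormal.1 i)
  rw [Finset.sum_add_distrib, ← Finset.mul_sum, ← Finset.mul_sum, ← Complex.re_sum,
    ← Complex.re_sum, ← hS, ← hA] at hsumE
  have r1 : ((N : ℂ) * (2 * S - A)).re = N * (2 * S.re - A.re) := by simp
  have r2 : ((N : ℂ) * S).re = N * S.re := by simp
  rw [r1, r2] at hsumX
  simp only [Finset.sum_const, Finset.card_range, Finset.card_univ, Fintype.card_fin,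
    nsmul_eq_mul] at hsumX hsumE
  have hX2 : ((n : ℝ) - k) * (2 * S.re - A.re) + ((k : ℝ) - 1) * n * S.re
      ≤ -((n : ℝ) - 1) * ((k : ℝ) + 1) * σ * n ^ 2 := by
    refine le_of_mul_le_mul_left ?_ hNpos
    linarith
  have hn1 : (1 : ℝ) < n := by
    have : 1 < n := by omega
    exact_mod_cast this
  have hpos : (0 : ℝ) < ((n : ℝ) - 1) * ((k : ℝ) + 1) := by
    have : (0 : ℝ) ≤ k := by positivity
    exact mul_pos (by linarith) (by linarith)
  refine le_of_mul_le_mul_left ?_ hpos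
  nlinarith [hX2, hsumE]
end

section
/- Let V be an n-dimensional complex inner product space, let k be an integer with 1 < k ≤ n, and let R be a Kähler-type curvature tensor on V with scalar curvature S. Then the supremum, over all k-dimensional complex subspaces Σ of V and all unit vectors X ∈ Σ, of Ric_k(Σ)(X,X̄) is at least (k+1)·S/(n(n+1)). In particular, there exist a k-dimensional complex subspace Σ and a unit vector X ∈ Σ with Ric_k(Σ)(X,X̄) ≥ (k+1)·S/(n(n+1)). -/
theorem KC_sum1 {V : Type*} [AddCommGroup V] [Module ℂ V] (T : KahlerCurvature V) {ι : Type*}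
    (s : Finset ι) (c : ι → ℂ) (e : ι → V) (Y Z W : V) :
    T.R (∑ i ∈ s, c i • e i) Y Z W = ∑ i ∈ s, c i * T.R (e i) Y Z W := by
  have := map_sum (AddMonoidHom.mk' (fun X => T.R X Y Z W) (fun a b => T.add1 a b Y Z W))
    (fun i => c i • e i) s
  simp only [AddMonoidHom.mk'_apply, T.smul1] at this
  exact this

theorem KC_sum2 {V : Type*} [AddCommGroup V] [Module ℂ V] (T : KahlerCurvature V) {ι : Type*}
    (s : Finset ι) (c : ι → ℂ) (e : ι → V) (Y Z W : V) :
    T.R Y (∑ i ∈ s, c i • e i) Z W = ∑ i ∈ s, (starRingEnd ℂ) (c i) * T.R Y (e i) Z W := by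
  have := map_sum (AddMonoidHom.mk' (fun X => T.R Y X Z W) (fun a b => T.add2 Y a b Z W))
    (fun i => c i • e i) s
  simp only [AddMonoidHom.mk'_apply, T.smul2] at this
  exact this

theorem KC_sum3 {V : Type*} [AddCommGroup V] [Module ℂ V] (T : KahlerCurvature V) {ι : Type*}
    (s : Finset ι) (c : ι → ℂ) (e : ι → V) (Y Z W : V) :
    T.R Y Z (∑ i ∈ s, c i • e i) W = ∑ i ∈ s, c i * T.R Y Z (e i) W := by
  rw [T.sym13, KC_sum1]
  exact Finset.sum_congr rfl fun i _ => by rw [T.sym13]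

theorem KC_sum4 {V : Type*} [AddCommGroup V] [Module ℂ V] (T : KahlerCurvature V) {ι : Type*}
    (s : Finset ι) (c : ι → ℂ) (e : ι → V) (Y Z W : V) :
    T.R Y Z W (∑ i ∈ s, c i • e i) = ∑ i ∈ s, (starRingEnd ℂ) (c i) * T.R Y Z W (e i) := by
  rw [T.sym24, KC_sum2]
  exact Finset.sum_congr rfl fun i _ => by rw [T.sym24]

/-- The trace in the last two slots does not depend on the orthonormal basis. -/
theorem KC_trace {V : Type*} [NormedAddCommGroup V] [InnerProductSpace ℂ V] {n : ℕ}
    (T : KahlerCurvature V) (e b : OrthonormalBasis (Fin n) ℂ V) (X Y : V) :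
    ∑ j, T.R X Y (b j) (b j) = ∑ j, T.R X Y (e j) (e j) := by
  have h : ∀ j, T.R X Y (b j) (b j) =
      ∑ i, ∑ l, inner ℂ (e i) (b j) * inner ℂ (b j) (e l) * T.R X Y (e i) (e l) := by
    intro j
    conv_lhs => rw [← e.sum_repr (b j), KC_sum3]
    refine Finset.sum_congr rfl fun i _ => ?_
    rw [KC_sum4, Finset.mul_sum]
    refine Finset.sum_congr rfl fun l _ => ?_
    rw [e.repr_apply_apply, e.repr_apply_apply, inner_conj_symm]
    ring
  simp_rw [h]
  rw [Finset.sum_comm]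
  refine Finset.sum_congr rfl fun i _ => ?_
  rw [Finset.sum_comm]
  simp_rw [← Finset.sum_mul, b.sum_inner_mul_inner]
  simp [orthonormal_iff_ite.mp e.orthonormal]

/-- the design vectors -/
noncomputable def KCvec {V : Type*} [AddCommGroup V] [Module ℂ V] {n : ℕ} (e : Fin n → V)
    (χ : AddChar (Fin n → ZMod 3) ℂ) : V := ∑ i, χ (Pi.single i 1) • e i

theorem KC_norm {V : Type*} [NormedAddCommGroup V] [InnerProductSpace ℂ V] {n : ℕ}
    (e : OrthonormalBasis (Fin n) ℂ V) (χ : AddChar (Fin n → ZMod 3) ℂ) :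
    ‖KCvec e χ‖ ^ 2 = n := by
  have h : inner ℂ (KCvec e χ) (KCvec e χ) = (n : ℂ) := by
    unfold KCvec
    rw [e.orthonormal.inner_sum]
    simp [← AddChar.map_neg_eq_conj, ← AddChar.map_add_eq_mul]
  rw [inner_self_eq_norm_sq_to_K] at h
  have h2 : ((‖KCvec e χ‖ ^ 2 : ℝ) : ℂ) = ((n : ℝ) : ℂ) := by
    push_cast
    exact h
  exact Complex.ofReal_injective h2

theorem KC_char2 {n : ℕ} (i j : Fin n) :
    ∑ χ : AddChar (Fin n → ZMod 3) ℂ, χ (Pi.single i 1) * (starRingEnd ℂ) (χ (Pi.single j 1))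
      = if i = j then (Fintype.card (Fin n → ZMod 3) : ℂ) else 0 := by
  simp_rw [← AddChar.map_neg_eq_conj, ← AddChar.map_add_eq_mul]
  rw [AddChar.sum_apply_eq_ite]
  congr 1
  rw [add_neg_eq_zero, eq_iff_iff]
  constructor
  · intro h
    by_contra hij
    have := congrFun h i
    simp [Pi.single_apply, hij] at this
  · rintro rfl; rfl

theorem KC_combi {n : ℕ} (i j k l : Fin n) :
    ((Pi.single i 1 + Pi.single k 1 : Fin n → ZMod 3) = Pi.single j 1 + Pi.single l 1) ↔
      (i = j ∧ k = l) ∨ (i = l ∧ k = j) := by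
  constructor
  · intro h
    have h1 := congrFun h i
    have h2 := congrFun h k
    have h3 := congrFun h j
    have h4 := congrFun h l
    simp only [Pi.add_apply, Pi.single_apply] at h1 h2 h3 h4
    have d1 : (1 : ZMod 3) ≠ 0 := by decide
    have d2 : (1 + 1 : ZMod 3) ≠ 0 := by decide
    have d3 : (1 + 1 : ZMod 3) ≠ 1 := by decide
    by_cases a1 : i = j
    · subst a1
      by_cases a2 : k = l
      · exact Or.inl ⟨rfl, a2⟩
      · exfalso
        have : (Pi.single k 1 : Fin n → ZMod 3) = Pi.single l 1 := add_left_cancel h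
        have := congrFun this k
        simp [Pi.single_apply, a2] at this
    · by_cases a2 : i = l
      · subst a2
        have := add_left_cancel (h.trans (add_comm _ _))
        have := congrFun this k
        by_cases a3 : k = j
        · exact Or.inr ⟨rfl, a3⟩
        · simp [Pi.single_apply, a3] at this
      · exfalso
        simp only [a1, a2, if_true, if_false] at h1
        split_ifs at h1
        · exact d2 (by simpa using h1)
        · exact d1 (by simpa using h1)
  · rintro (⟨rfl, rfl⟩ | ⟨rfl, rfl⟩)
    · rfl
    · exact add_comm _ _

theorem KC_char4 {n : ℕ} (i j k l : Fin n) :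
    ∑ χ : AddChar (Fin n → ZMod 3) ℂ, χ (Pi.single i 1) * (starRingEnd ℂ) (χ (Pi.single j 1))
       * χ (Pi.single k 1) * (starRingEnd ℂ) (χ (Pi.single l 1))
      = (Fintype.card (Fin n → ZMod 3) : ℂ) *
        ((if i = j then if k = l then 1 else 0 else 0)
          + (if i = l then if k = j then 1 else 0 else 0)
          - (if i = j then if k = l then if i = k then 1 else 0 else 0 else 0)) := by
  simp_rw [← AddChar.map_neg_eq_conj, ← AddChar.map_add_eq_mul]
  rw [AddChar.sum_apply_eq_ite]
  have : (Pi.single i 1 + -Pi.single j 1 + Pi.single k 1 + -Pi.single l 1 : Fin n → ZMod 3) = 0 ↔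
      (i = j ∧ k = l) ∨ (i = l ∧ k = j) := by
    rw [← KC_combi, ← sub_eq_zero (b := Pi.single j 1 + Pi.single l 1)]
    apply Eq.congr_left
    abel
  rw [if_congr this rfl rfl]
  grind

theorem KC_sumRic {V : Type*} [AddCommGroup V] [Module ℂ V] {n : ℕ} (T : KahlerCurvature V)
    (e : Fin n → V) (Z W : V) :
    ∑ χ, T.R (KCvec e χ) (KCvec e χ) Z W =
      (Fintype.card (Fin n → ZMod 3) : ℂ) * ∑ i, T.R (e i) (e i) Z W := by
  unfold KCvec
  simp_rw [KC_sum1, KC_sum2, Finset.mul_sum, ← mul_assoc]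
  rw [Finset.sum_comm]
  refine Finset.sum_congr rfl fun i _ => ?_
  rw [Finset.sum_comm]
  simp_rw [← Finset.sum_mul, KC_char2]
  simp

theorem KC_sumH {V : Type*} [AddCommGroup V] [Module ℂ V] {n : ℕ} (T : KahlerCurvature V)
    (e : Fin n → V) :
    ∑ χ, T.R (KCvec e χ) (KCvec e χ) (KCvec e χ) (KCvec e χ) =
      (Fintype.card (Fin n → ZMod 3) : ℂ) * (2 * (∑ i, ∑ j, T.R (e i) (e i) (e j) (e j))
        - ∑ i, T.R (e i) (e i) (e i) (e i)) := by
  have h : ∀ χ : AddChar (Fin n → ZMod 3) ℂ,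
      T.R (KCvec e χ) (KCvec e χ) (KCvec e χ) (KCvec e χ) = ∑ i, ∑ j, ∑ k, ∑ l,
      (χ (Pi.single i 1) * (starRingEnd ℂ) (χ (Pi.single j 1))
       * χ (Pi.single k 1) * (starRingEnd ℂ) (χ (Pi.single l 1))) *
        T.R (e i) (e j) (e k) (e l) := by
    intro χ
    conv_lhs => unfold KCvec
    simp_rw [KC_sum1, KC_sum2, KC_sum3, KC_sum4, Finset.mul_sum, ← mul_assoc]
  simp_rw [h]
  have h2 : ∀ F : AddChar (Fin n → ZMod 3) ℂ → Fin n → Fin n → Fin n → Fin n → ℂ,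
      ∑ χ, ∑ i, ∑ j, ∑ k, ∑ l, F χ i j k l = ∑ i, ∑ j, ∑ k, ∑ l, ∑ χ, F χ i j k l := by
    intro F
    rw [Finset.sum_comm]; refine Finset.sum_congr rfl fun i _ => ?_
    rw [Finset.sum_comm]; refine Finset.sum_congr rfl fun j _ => ?_
    rw [Finset.sum_comm]; refine Finset.sum_congr rfl fun k _ => ?_
    rw [Finset.sum_comm]
  rw [h2]
  simp_rw [← Finset.sum_mul, KC_char4, mul_assoc, ← Finset.mul_sum]
  congr 1
  simp_rw [sub_mul, add_mul, Finset.sum_sub_distrib, Finset.sum_add_distrib, two_mul]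
  congr 1
  · congr 1
    · simp
    · simp only [ite_mul, one_mul, zero_mul, Finset.sum_ite_eq, Finset.mem_univ, if_true]
      refine Finset.sum_congr rfl fun i _ => ?_
      rw [Finset.sum_comm]
      simp only [Finset.sum_ite_eq, Finset.mem_univ, if_true, Finset.sum_ite_irrel]
      refine (Finset.sum_congr rfl fun k _ => ?_)
      simp [T.sym24 (e i) (e k) (e k) (e i)]
  · simp

theorem KC_select {ι : Type*} [DecidableEq ι] (v : ι → ℝ) (m : ℕ) (N : ℕ) :
    ∀ A : Finset ι, A.card = N → m ≤ N →
      ∃ s ⊆ A, s.card = m ∧ (m : ℝ) * ∑ i ∈ A, v i ≤ (N : ℝ) * ∑ i ∈ s, v i := by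
  induction N with
  | zero =>
    intro A hA hm
    exact ⟨A, subset_rfl, by omega, by
      have : m = 0 := by omega
      simp [this]⟩
  | succ N ih =>
    intro A hA hm
    rcases Nat.eq_or_lt_of_le hm with h | h
    · exact ⟨A, subset_rfl, by omega, by rw [h]⟩
    · obtain ⟨x, hx, hmin⟩ := Finset.exists_min_image A v (Finset.card_pos.mp (by omega))
      obtain ⟨s, hs, hc, hi⟩ := ih (A.erase x) (by rw [Finset.card_erase_of_mem hx]; omega)
        (by omega)
      refine ⟨s, hs.trans (Finset.erase_subset _ _), hc, ?_⟩
      rw [← Finset.add_sum_erase A v hx]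
      have hsx : (m : ℝ) * v x ≤ ∑ i ∈ s, v i := by
        have := Finset.card_nsmul_le_sum s v (v x)
          fun i his => hmin i (Finset.mem_of_mem_erase (hs his))
        simpa [hc] using this
      push_cast
      linarith

/-- Pointwise content of Proposition 1.2: for `1 < k ≤ n`, the maximal
`k`-Ricci curvature is at least `(k+1) S / (n(n+1))`; in particular there exist
a `k`-dimensional complex subspace `Σ` and a unit vector `X ∈ Σ` with
`Ric_k(Σ)(X,X̄) ≥ (k+1) S / (n(n+1))`, where `S` is the scalar curvature. -/
theorem stmt4 {V : Type*} [NormedAddCommGroup V] [InnerProductSpace ℂ V]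
    [FiniteDimensional ℂ V]
    (n k : ℕ) (hn : Module.finrank ℂ V = n) (hk1 : 1 < k) (hkn : k ≤ n)
    (T : KahlerCurvature V)
    (e : OrthonormalBasis (Fin n) ℂ V) :
    ∃ P : Submodule ℂ V, Module.finrank ℂ P = k ∧
      ∃ (f : OrthonormalBasis (Fin k) ℂ P) (X : V), X ∈ P ∧ ‖X‖ = 1 ∧
        ((k : ℝ) + 1) * (∑ i, ∑ j, T.R (e i) (e i) (e j) (e j)).re
            / ((n : ℝ) * ((n : ℝ) + 1))
          ≤ (∑ j, T.R X X (f j : V) (f j : V)).re := by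
  set S := (∑ i, ∑ j, T.R (e i) (e i) (e j) (e j)).re with hS
  have hkR : (1 : ℝ) < k := by exact_mod_cast hk1
  have hnR : (k : ℝ) ≤ n := by exact_mod_cast hkn
  set c := ((k : ℝ) + 1) * S / ((n : ℝ) * ((n : ℝ) + 1)) with hc
  have hcS : c * (n * (n + 1)) = (k + 1) * S := by
    rw [hc]; apply div_mul_cancel₀
    have : (0 : ℝ) < n := by linarith
    positivity
  -- a good unit vector
  obtain ⟨X, hX, hQ⟩ : ∃ X : V, ‖X‖ = 1 ∧ ((n : ℝ) - 1) * c ≤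
      ((n : ℝ) - k) * (T.R X X X X).re + ((k : ℝ) - 1) * (∑ j, T.R X X (e j) (e j)).re := by
    by_contra! hcon
    have hE : ∑ i, (((n : ℝ) - k) * (T.R (e i) (e i) (e i) (e i)).re
        + ((k : ℝ) - 1) * (∑ j, T.R (e i) (e i) (e j) (e j)).re) < n * (((n : ℝ) - 1) * c) := by
      have : ∑ i : Fin n, (((n : ℝ) - 1) * c) = n * (((n : ℝ) - 1) * c) := by simp
      rw [← this]
      have : NeZero n := ⟨by omega⟩
      exact Finset.sum_lt_sum_of_nonempty Finset.univ_nonempty fun i _ => hcon _ (e.norm_eq_one i)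
    have hV : ∀ χ, ((n : ℝ) - k) *
          (T.R (KCvec e χ) (KCvec e χ) (KCvec e χ) (KCvec e χ)).re
        + ((k : ℝ) - 1) * (n * (∑ j, T.R (KCvec e χ) (KCvec e χ) (e j) (e j)).re)
        ≤ n ^ 2 * (((n : ℝ) - 1) * c) := by
      intro χ
      set Y := KCvec e χ with hY
      have hYn : ‖Y‖ ^ 2 = n := KC_norm e χ
      have hn0 : (0 : ℝ) < n := by linarith
      have hY0 : ‖Y‖ ≠ 0 := by
        intro h0; rw [h0] at hYn; norm_num at hYn; linarith
      set r : ℝ := ‖Y‖ with hr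
      set U : V := ((r : ℂ)⁻¹) • Y with hU
      have hUY : Y = (r : ℂ) • U := by
        rw [hU, smul_smul, mul_inv_cancel₀ (by exact_mod_cast hY0), one_smul]
      have hU1 : ‖U‖ = 1 := by
        rw [hU, norm_smul, norm_inv, Complex.norm_real, Real.norm_eq_abs,
          abs_of_nonneg (norm_nonneg _)]
        exact inv_mul_cancel₀ hY0
      have h := (hcon U hU1).le
      have e1 : (T.R Y Y Y Y).re = n ^ 2 * (T.R U U U U).re := by
        rw [hUY, T.smul1, T.smul2, T.smul3, T.smul4, Complex.conj_ofReal]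
        simp only [Complex.re_ofReal_mul]
        rw [← hYn]; ring
      have e2 : (∑ j, T.R Y Y (e j) (e j)).re = n * (∑ j, T.R U U (e j) (e j)).re := by
        rw [hUY]
        simp_rw [T.smul1, T.smul2, Complex.conj_ofReal, ← Finset.mul_sum]
        simp only [Complex.re_ofReal_mul]
        rw [← hYn]; ring
      rw [e1, e2]
      have := mul_le_mul_of_nonneg_left h (sq_nonneg (n : ℝ))
      linarith
    have hsum := Finset.sum_le_sum (s := Finset.univ) fun χ _ => hV χ
    have hcard : Fintype.card (AddChar (Fin n → ZMod 3) ℂ) = Fintype.card (Fin n → ZMod 3) := 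
      AddChar.card_eq
    set N : ℝ := (Fintype.card (Fin n → ZMod 3) : ℝ) with hN
    have hN0 : 0 < N := by rw [hN]; exact_mod_cast Fintype.card_pos
    have s1 := congrArg Complex.re (KC_sumH T e)
    have s2 : (∑ χ, ∑ j, T.R (KCvec e χ) (KCvec e χ) (e j) (e j)).re = N * S := by
      rw [Finset.sum_comm]
      simp_rw [KC_sumRic]
      rw [← Finset.mul_sum, Finset.sum_comm, hS, hN, ← Complex.ofReal_natCast,
        Complex.re_ofReal_mul]
    rw [← Complex.ofReal_natCast, Complex.re_ofReal_mul, ← hN, Complex.sub_re,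
      show (2 : ℂ) = ((2 : ℝ) : ℂ) by norm_num, Complex.re_ofReal_mul, ← hS] at s1
    rw [Finset.sum_add_distrib, ← Finset.mul_sum, ← Finset.mul_sum, ← Finset.mul_sum,
      ← Complex.re_sum, ← Complex.re_sum, s1, s2, Finset.sum_const, Finset.card_univ, hcard,
      nsmul_eq_mul, ← hN] at hsum
    rw [Finset.sum_add_distrib, ← Finset.mul_sum, ← Finset.mul_sum, 
      ← Complex.re_sum, ← Complex.re_sum, ← hS] at hE
    set h := (∑ i, T.R (e i) (e i) (e i) (e i)).re
    have hsum' : ((n : ℝ) - k) * (2 * S - h) + ((k : ℝ) - 1) * (n * S)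
        ≤ n ^ 2 * (((n : ℝ) - 1) * c) := by
      refine le_of_mul_le_mul_left ?_ hN0
      linarith
    have : ((n : ℝ) - 1) * (c * (n * (n + 1))) = ((n : ℝ) - 1) * ((k + 1) * S) := by rw [hcS]
    linarith
  -- extend to an orthonormal basis
  have : NeZero n := ⟨by omega⟩
  obtain ⟨b, hb⟩ := Orthonormal.exists_orthonormalBasis_extension_of_card_eq (𝕜 := ℂ) (E := V)
    (ι := Fin n) (by simp [hn]) (v := fun _ => X) (s := {0})
    ⟨fun _ => hX, fun i j hij => (hij (Subsingleton.elim _ _)).elim⟩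
  have hb0 : b 0 = X := hb 0 rfl
  rw [← KC_trace T e b] at hQ
  set v : Fin n → ℝ := fun j => (T.R X X (b j) (b j)).re with hv
  obtain ⟨s, hs, hsc, hsi⟩ := KC_select v (k - 1) (n - 1) (Finset.univ.erase 0) (by simp) (by omega)
  have h0s : (0 : Fin n) ∉ s := fun h => by simpa using hs h
  have htc : (insert 0 s).card = k := by rw [Finset.card_insert_of_notMem h0s]; omega
  have hfull : (∑ j, T.R X X (b j) (b j)).re = v 0 + ∑ i ∈ Finset.univ.erase 0, v i := by
    rw [Finset.add_sum_erase _ _ (Finset.mem_univ _), Complex.re_sum]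
  have hv0 : (T.R X X X X).re = v 0 := by simp only [hv, hb0]
  classical
  let f0 := OrthonormalBasis.span b.orthonormal (insert 0 s)
  let f := f0.reindex ((insert 0 s).equivFinOfCardEq htc)
  refine ⟨_, ?_, f, X, ?_, hX, ?_⟩
  · rw [Module.finrank_eq_card_basis f.toBasis]; simp
  · apply Submodule.subset_span
    rw [← hb0]
    simp
  · have hsumf : ∑ j, T.R X X (f j : V) (f j : V) = ∑ j ∈ insert 0 s, T.R X X (b j) (b j) := by
      rw [← Finset.sum_coe_sort (insert 0 s)]
      refine Fintype.sum_equiv ((insert 0 s).equivFinOfCardEq htc).symm _ _ fun j => ?_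
      simp [f, f0, OrthonormalBasis.span_apply]
    rw [hsumf, Complex.re_sum, Finset.sum_insert h0s]
    change c ≤ v 0 + ∑ i ∈ s, v i
    rw [hfull, hv0] at hQ
    rw [Nat.cast_sub (by omega), Nat.cast_sub (by omega)] at hsi
    push_cast at hsi
    have : (0 : ℝ) < n - 1 := by linarith
    refine le_of_mul_le_mul_left ?_ this
    linarith
end
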